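/- arXiv:2502.10103 — 6 statements merged into one kernel-verified Lean document; each statement's English description precedes it below -/
import Mathlib

section
/- Let S be a finite inverse semigroup, let s ∈ S and u, v ∈ S¹. If usv ≥_J s (that is, s ∈ S¹(usv)S¹), then ū u s v v̄ = s. -/
/-- Extension of the inverse operation `inv` of `S` to `S¹ = WithOne S`, sending `1` to `1`. -/
def invOne {S : Type*} (inv : S → S) : WithOne S → WithOne S :=
  WithOne.recOneCoe 1 (fun a => ((inv a : S) : WithOne S))

theorem idem_comm_aux {M : Type*} [Monoid M] (inv : M → M)
    (h1 : ∀ x : M, x * inv x * x = x) (h2 : ∀ x : M, inv x * x * inv x = inv x)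
    (hU : ∀ x y : M, x * y * x = x → y * x * y = y → y = inv x)
    (e f : M) (he : e * e = e) (hf : f * f = f) : e * f = f * e := by
  have key : ∀ e f : M, e * e = e → f * f = f → (e * f) * (e * f) = e * f := by
    intro e f he hf
    have a1 := h1 (e * f)
    have a2 := h2 (e * f)
    generalize hx : inv (e * f) = x at a1 a2
    have b : f * x * e = x := by
      rw [← hx]
      apply hU
      · rw [hx]
        calc e * f * (f * x * e) * (e * f) = e * (f * f) * x * (e * e) * f := by
              simp only [mul_assoc]
          _ = e * f * x * (e * f) := by rw [he, hf]; simp only [mul_assoc]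
          _ = e * f := a1
      · rw [hx]
        calc f * x * e * (e * f) * (f * x * e) = f * x * (e * e) * (f * f) * x * e := by
              simp only [mul_assoc]
          _ = f * (x * (e * f) * x) * e := by rw [he, hf]; simp only [mul_assoc]
          _ = f * x * e := by rw [a2]
    have c : x * x = x := by
      calc x * x = (f * x * e) * (f * x * e) := by rw [b]
        _ = f * (x * (e * f) * x) * e := by simp only [mul_assoc]
        _ = x := by rw [a2, b]
    have d1 : e * f = inv x := hU x (e * f) a2 a1
    have d2 : x = inv x := hU x x (by rw [c, c]) (by rw [c, c])
    rw [d1, ← d2, c]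
  have k1 := key e f he hf
  have k2 := key f e hf he
  have d2 : e * f = inv (e * f) := hU _ _ (by rw [k1, k1]) (by rw [k1, k1])
  have d1 : f * e = inv (e * f) := by
    apply hU
    · calc e * f * (f * e) * (e * f) = e * (f * f) * (e * e) * f := by simp only [mul_assoc]
        _ = e * f := by rw [he, hf, mul_assoc, mul_assoc, ← mul_assoc, k1]
    · calc f * e * (e * f) * (f * e) = f * (e * e) * (f * f) * e := by simp only [mul_assoc]
        _ = f * e := by rw [he, hf, mul_assoc, mul_assoc, ← mul_assoc, k2]
  rw [d1, ← d2]

theorem monoid_aux {M : Type*} [Monoid M] [Finite M] (inv : M → M)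
    (h1 : ∀ x : M, x * inv x * x = x) (h2 : ∀ x : M, inv x * x * inv x = inv x)
    (hU : ∀ x y : M, x * y * x = x → y * x * y = y → y = inv x)
    (s u v p q : M) (hJ : s = p * (u * s * v) * q) :
    inv u * u * s * v * inv v = s := by
  have comm := idem_comm_aux inv h1 h2 hU
  have il : ∀ x : M, (inv x * x) * (inv x * x) = inv x * x := by
    intro x; rw [← mul_assoc, h2]
  have ir : ∀ x : M, (x * inv x) * (x * inv x) = x * inv x := by
    intro x; rw [← mul_assoc, h1]
  have hn : ∀ n : ℕ, (p * u) ^ n * s * (v * q) ^ n = s := by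
    intro n
    induction n with
    | zero => simp
    | succ n ih =>
      calc (p * u) ^ (n+1) * s * (v * q) ^ (n+1)
          = (p * u) ^ n * (p * (u * s * v) * q) * (v * q) ^ n := by
            rw [pow_succ, pow_succ']; simp only [mul_assoc]
        _ = s := by rw [← hJ, ih]
  have L : ∃ w, w * u * s = s := by
    obtain ⟨i, j, hij, h⟩ := Set.finite_univ.exists_lt_map_eq_of_forall_mem
      (f := fun n : ℕ => (p * u) ^ n) (fun _ => Set.mem_univ _)
    obtain ⟨k, rfl⟩ := Nat.exists_eq_add_of_lt hij
    refine ⟨(p * u) ^ k * p, ?_⟩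
    have h' : (p * u) ^ i = (p * u) ^ (k + 1) * (p * u) ^ i := by
      rw [← pow_add]; convert h using 2; omega
    calc (p * u) ^ k * p * u * s = (p * u) ^ (k+1) * s := by
          rw [pow_succ]; simp only [mul_assoc]
      _ = (p * u) ^ (k+1) * ((p * u) ^ i * s * (v * q) ^ i) := by rw [hn]
      _ = ((p * u) ^ (k+1) * (p * u) ^ i) * s * (v * q) ^ i := by simp only [mul_assoc]
      _ = s := by rw [← h', hn]
  have R : ∃ w, s * (v * w) = s := by
    obtain ⟨i, j, hij, h⟩ := Set.finite_univ.exists_lt_map_eq_of_forall_mem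
      (f := fun n : ℕ => (v * q) ^ n) (fun _ => Set.mem_univ _)
    obtain ⟨k, rfl⟩ := Nat.exists_eq_add_of_lt hij
    refine ⟨q * (v * q) ^ k, ?_⟩
    have h' : (v * q) ^ i = (v * q) ^ i * (v * q) ^ (k + 1) := by
      rw [← pow_add]; exact h
    calc s * (v * (q * (v * q) ^ k)) = s * (v * q) ^ (k+1) := by
          rw [pow_succ']; simp only [mul_assoc]
      _ = ((p * u) ^ i * s * (v * q) ^ i) * (v * q) ^ (k+1) := by rw [hn]
      _ = (p * u) ^ i * s * ((v * q) ^ i * (v * q) ^ (k+1)) := by simp only [mul_assoc]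
      _ = s := by rw [← h', hn]
  obtain ⟨w, hw⟩ := L
  obtain ⟨z, hz⟩ := R
  have e1 : inv u * u * (s * inv s) = s * inv s := by
    have c := comm (inv u * u) (s * inv s) (il u) (ir s)
    calc inv u * u * (s * inv s) = s * inv s * (inv u * u) := c
      _ = (w * u * s) * inv s * (inv u * u) := by rw [hw]
      _ = w * u * (s * inv s * (inv u * u)) := by simp only [mul_assoc]
      _ = w * (u * inv u * u) * s * inv s := by rw [← c]; simp only [mul_assoc]
      _ = s * inv s := by rw [h1, hw]
  have e2 : inv s * s * (v * inv v) = inv s * s := by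
    have c := comm (inv s * s) (v * inv v) (il s) (ir v)
    calc inv s * s * (v * inv v) = v * inv v * (inv s * s) := c
      _ = v * inv v * (inv s * (s * (v * z))) := by rw [hz]
      _ = (v * inv v * (inv s * s)) * (v * z) := by simp only [mul_assoc]
      _ = inv s * (s * ((v * inv v * v) * z)) := by rw [← c]; simp only [mul_assoc]
      _ = inv s * s := by rw [h1, hz]
  have f1 : inv u * u * s = s := by
    calc inv u * u * s = inv u * u * (s * inv s * s) := by rw [h1]
      _ = inv u * u * (s * inv s) * s := by simp only [mul_assoc]
      _ = s := by rw [e1, h1]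
  calc inv u * u * s * v * inv v = s * v * inv v := by rw [f1]
    _ = (s * inv s * s) * v * inv v := by rw [h1]
    _ = s * (inv s * s * (v * inv v)) := by simp only [mul_assoc]
    _ = s := by rw [e2, ← mul_assoc, h1]

/-- Let `S` be a finite inverse semigroup (with inverse operation `inv`),
let `s ∈ S` and `u, v ∈ S¹`.  If `u s v ≥_J s`, i.e. `s ∈ S¹ (u s v) S¹`, then
`ū u s v v̄ = s`. -/
theorem stmt_0 {S : Type*} [Semigroup S] [Finite S] (inv : S → S)
    (hinv1 : ∀ x : S, x * inv x * x = x)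
    (hinv2 : ∀ x : S, inv x * x * inv x = inv x)
    (hinvUniq : ∀ x y : S, x * y * x = x → y * x * y = y → y = inv x)
    (s : S) (u v : WithOne S)
    (hJ : ∃ p q : WithOne S, (s : WithOne S) = p * (u * (s : WithOne S) * v) * q) :
    invOne inv u * u * (s : WithOne S) * v * invOne inv v = (s : WithOne S) := by
  obtain ⟨p, q, hJ⟩ := hJ
  haveI : Finite (WithOne S) := inferInstanceAs (Finite (Option S))
  refine monoid_aux (invOne inv) ?_ ?_ ?_ _ u v p q hJ
  · intro x
    induction x using WithOne.recOneCoe with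
    | one => rfl
    | coe a => exact congrArg WithOne.coe (hinv1 a)
  · intro x
    induction x using WithOne.recOneCoe with
    | one => rfl
    | coe a => exact congrArg WithOne.coe (hinv2 a)
  · intro x y hx hy
    induction x using WithOne.recOneCoe with
    | one => exact (by simpa using hx : y = 1)
    | coe a =>
      induction y using WithOne.recOneCoe with
      | one => simp at hy
      | coe b =>
        exact congrArg WithOne.coe (hinvUniq a b (by exact_mod_cast hx) (by exact_mod_cast hy))
end

section
/- Let U ≤ S be inverse semigroups and let e, e′ ∈ E(S) be idempotents. Then e ≥_{J_U} e′ (that is, e′ ∈ U¹ e U¹) holds if and only if e′ = ū e u for some u ∈ U¹. If moreover S is finite, then e J_U e′ holds if and only if e ∼_U e′. -/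
namespace InvMon

variable {T : Type*} [Monoid T] {i : T → T}

/-- The inverse-monoid axioms. -/
structure IsInv (i : T → T) : Prop where
  h1 : ∀ x, x * i x * x = x
  h2 : ∀ x, i x * x * i x = i x
  h3 : ∀ x y, x * y * x = x → y * x * y = y → y = i x

theorem inv_idem (h : IsInv i) {e : T} (he : e * e = e) : i e = e :=
  (h.h3 e e (by rw [he, he]) (by rw [he, he])).symm

theorem inv_inv (h : IsInv i) (x : T) : i (i x) = x :=
  (h.h3 (i x) x (h.h2 x) (h.h1 x)).symm

theorem idem_mul (h : IsInv i) {e f : T} (he : e * e = e) (hf : f * f = f) :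
    (e * f) * (e * f) = e * f := by
  obtain ⟨x, hx⟩ : ∃ x, x = i (e * f) := ⟨_, rfl⟩
  have a1 := h.h1 (e * f)
  have a2 := h.h2 (e * f)
  rw [← hx] at a1 a2
  have hx2 : f * x * e = x := by
    rw [hx]
    apply h.h3
    · rw [← hx]
      calc e * f * (f * x * e) * (e * f) = e * (f * f) * x * ((e * e) * f) := by
            simp only [mul_assoc]
        _ = _ := by rw [he, hf, a1]
    · rw [← hx]
      calc f * x * e * (e * f) * (f * x * e) = f * (x * ((e * e) * (f * f)) * x) * e := by
            simp only [mul_assoc]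
        _ = _ := by rw [he, hf, a2]
  have hxx : x * x = x := by
    calc x * x = (f * x * e) * (f * x * e) := by rw [hx2]
      _ = f * (x * (e * f) * x) * e := by simp only [mul_assoc]
      _ = x := by rw [a2, hx2]
  have : e * f = x := by
    rw [← inv_idem h hxx, hx, inv_inv h]
  rw [this, hxx]

theorem idem_comm (h : IsInv i) {e f : T} (he : e * e = e) (hf : f * f = f) :
    e * f = f * e := by
  have k1 := idem_mul h he hf
  have k2 := idem_mul h hf he
  rw [← inv_idem h k1]
  symm
  apply h.h3
  · calc e * f * (f * e) * (e * f) = e * (f * f) * ((e * e) * f) := by simp only [mul_assoc]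
      _ = _ := by rw [he, hf, k1]
  · calc f * e * (e * f) * (f * e) = f * (e * e) * ((f * f) * e) := by simp only [mul_assoc]
      _ = _ := by rw [he, hf, k2]

theorem idem_r (h : IsInv i) (x : T) : (x * i x) * (x * i x) = x * i x := by
  rw [← mul_assoc, h.h1]

theorem idem_l (h : IsInv i) (x : T) : (i x * x) * (i x * x) = i x * x := by
  rw [← mul_assoc, h.h2]

theorem inv_mul (h : IsInv i) (a b : T) : i (a * b) = i b * i a := by
  symm
  have c := idem_comm h (idem_r h b) (idem_l h a)
  apply h.h3
  · calc a * b * (i b * i a) * (a * b) = a * ((b * i b) * (i a * a)) * b := by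
          simp only [mul_assoc]
      _ = (a * i a * a) * (b * i b * b) := by rw [c]; simp only [mul_assoc]
      _ = _ := by rw [h.h1, h.h1]
  · calc i b * i a * (a * b) * (i b * i a) = i b * ((i a * a) * (b * i b)) * i a := by
          simp only [mul_assoc]
      _ = (i b * b * i b) * (i a * a * i a) := by rw [← c]; simp only [mul_assoc]
      _ = _ := by rw [h.h2, h.h2]

theorem part1 (h : IsInv i) {e e' p q : T} (he : e * e = e) (he' : e' * e' = e')
    (hp : e' = p * e * q) : i (q * i q * i p) * e * (q * i q * i p) = e' := by
  have c := idem_comm h he (idem_r h q)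
  have k : i e' = i q * e * i p := by
    rw [hp, inv_mul h, inv_mul h, inv_idem h he, mul_assoc]
  rw [inv_mul h, inv_inv h, inv_idem h (idem_r h q)]
  calc p * (q * i q) * e * (q * i q * i p) = p * ((q * i q) * e) * (q * i q) * i p := by
        simp only [mul_assoc]
    _ = p * (e * e * (q * i q)) * (q * i q) * i p := by rw [← c, he]
    _ = p * e * (e * ((q * i q) * (q * i q))) * i p := by simp only [mul_assoc]
    _ = p * e * ((q * i q) * e) * i p := by rw [idem_r h, c]
    _ = (p * e * q) * (i q * e * i p) := by simp only [mul_assoc]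
    _ = e' * i e' := by rw [← hp, ← k]
    _ = e' := by rw [inv_idem h he', he']

theorem exists_idem [Finite T] (w : T) : ∃ n, w ^ (n + 1) * w ^ (n + 1) = w ^ (n + 1) := by
  obtain ⟨a, b, hab, hw⟩ : ∃ a b, a < b ∧ w ^ a = w ^ b := by
    obtain ⟨a, b, hne, hw⟩ := Finite.exists_ne_map_eq_of_infinite (fun n : ℕ => w ^ n)
    rcases lt_or_gt_of_ne hne with l | l
    · exact ⟨a, b, l, hw⟩
    · exact ⟨b, a, l, hw.symm⟩
  obtain ⟨d, rfl⟩ := Nat.exists_eq_add_of_lt hab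
  have step : ∀ k m, w ^ (a + m) = w ^ (a + m + k * (d + 1)) := by
    intro k m
    induction k with
    | zero => simp
    | succ k ih =>
      rw [ih]
      have : w ^ (a + (m + k * (d + 1))) = w ^ (a + d + 1 + (m + k * (d + 1))) := by
        rw [pow_add, hw, ← pow_add]
      convert this using 2 <;> ring
  -- exponent (a+1)(d+1)
  refine ⟨a + (a * d + d), ?_⟩
  rw [← pow_add]
  have := step (a + 1) (a * d + d + 1)
  convert this.symm using 2 <;> ring

theorem conj_pow (h : IsInv i) {e w : T} (hw : i w * e * w = e) (n : ℕ) :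
    i (w ^ (n + 1)) * e * w ^ (n + 1) = e := by
  induction n with
  | zero => simpa using hw
  | succ n ih =>
    rw [pow_succ w (n + 1), inv_mul h]
    calc i w * i (w ^ (n + 1)) * e * (w ^ (n + 1) * w)
        = i w * (i (w ^ (n + 1)) * e * w ^ (n + 1)) * w := by simp only [mul_assoc]
      _ = e := by rw [ih, hw]

theorem part2 [Finite T] (h : IsInv i) {e e' u v : T} (he : e * e = e)
    (hu : i u * e * u = e') (hv : i v * e' * v = e) : u * e' * i u = e := by
  have hw : i (u * v) * e * (u * v) = e := by
    rw [inv_mul h]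
    calc i v * i u * e * (u * v) = i v * (i u * e * u) * v := by simp only [mul_assoc]
      _ = e := by rw [hu, hv]
  obtain ⟨n, hn⟩ := exists_idem (u * v)
  have hp := conj_pow h hw n
  have huf : u * i u * (u * v) ^ (n + 1) = (u * v) ^ (n + 1) := by
    rw [pow_succ']
    simp only [← mul_assoc]
    rw [h.h1]
  obtain ⟨f, hf⟩ : ∃ f, f = (u * v) ^ (n + 1) := ⟨_, rfl⟩
  rw [← hf] at hn hp huf
  rw [inv_idem h hn] at hp
  have hue : u * i u * e = e := by
    calc u * i u * e = (u * i u * f) * e * f := by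
          conv_lhs => rw [← hp]
          simp only [mul_assoc]
      _ = e := by rw [huf, hp]
  have c := idem_comm h he (idem_r h u)
  rw [← hu]
  calc u * (i u * e * u) * i u = (u * i u * e) * (u * i u) := by simp only [mul_assoc]
    _ = e := by rw [hue, c, hue]

end InvMon


/-- `U¹ = U ∪ {1}`, viewed inside `S¹ = WithOne S`. -/
def Uone {S : Type*} [Semigroup S] (U : Set S) : Set (WithOne S) :=
  insert 1 ((fun a : S => (a : WithOne S)) '' U)

/-- `s ≥_{J_U} t`, i.e. `t ∈ U¹ s U¹`. -/
def geJrel {S : Type*} [Semigroup S] (U : Set S) (s t : S) : Prop :=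
  ∃ p ∈ Uone U, ∃ q ∈ Uone U, (t : WithOne S) = p * (s : WithOne S) * q

/-- `s ∼_U t`: conjugacy relative to `U`, i.e. there is `u ∈ U¹` with
`ū s u = t` and `u t ū = s`. -/
def conjRel {S : Type*} [Semigroup S] (inv : S → S) (U : Set S) (s t : S) : Prop :=
  ∃ u ∈ Uone U, invOne inv u * (s : WithOne S) * u = (t : WithOne S) ∧
    u * (t : WithOne S) * invOne inv u = (s : WithOne S)

/-- Let `U ≤ S` be inverse semigroups and `e, e′ ∈ E(S)` idempotents.
Then `e ≥_{J_U} e′` (i.e. `e′ ∈ U¹ e U¹`) iff `e′ = ū e u` for some `u ∈ U¹`.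
If moreover `S` is finite, then `e J_U e′` iff `e ∼_U e′`. -/
theorem stmt_2 {S : Type*} [Semigroup S] (inv : S → S)
    (hinv1 : ∀ x : S, x * inv x * x = x)
    (hinv2 : ∀ x : S, inv x * x * inv x = inv x)
    (hinvUniq : ∀ x y : S, x * y * x = x → y * x * y = y → y = inv x)
    (U : Set S) (hUmul : ∀ a ∈ U, ∀ b ∈ U, a * b ∈ U) (hUinv : ∀ a ∈ U, inv a ∈ U)
    (e e' : S) (he : e * e = e) (he' : e' * e' = e') :
    (geJrel U e e' ↔ ∃ u ∈ Uone U, invOne inv u * (e : WithOne S) * u = (e' : WithOne S)) ∧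
    (Finite S → ((geJrel U e e' ∧ geJrel U e' e) ↔ conjRel inv U e e')) := by
  have h : InvMon.IsInv (invOne inv) := by
    refine ⟨?_, ?_, ?_⟩
    · intro x
      induction x using WithOne.recOneCoe with
      | one => rfl
      | coe a => exact congrArg WithOne.coe (hinv1 a)
    · intro x
      induction x using WithOne.recOneCoe with
      | one => rfl
      | coe a => exact congrArg WithOne.coe (hinv2 a)
    · intro x y
      induction x using WithOne.recOneCoe with
      | one =>
        intro h1 _
        have h4 : y = 1 := by simpa using h1
        exact h4
      | coe a =>
        induction y using WithOne.recOneCoe with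
        | one =>
          intro _ h2
          simp at h2
        | coe b =>
          intro h1 h2
          exact congrArg WithOne.coe
            (hinvUniq a b (WithOne.coe_injective h1) (WithOne.coe_injective h2))
  have hm : ∀ a ∈ Uone U, ∀ b ∈ Uone U, a * b ∈ Uone U := by
    rintro a (rfl | ⟨a, ha, rfl⟩) b (rfl | ⟨b, hb, rfl⟩)
    · exact Or.inl rfl
    · exact Or.inr ⟨b, hb, rfl⟩
    · exact Or.inr ⟨a, ha, rfl⟩
    · exact Or.inr ⟨a * b, hUmul a ha b hb, rfl⟩
  have hi : ∀ a ∈ Uone U, invOne inv a ∈ Uone U := by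
    rintro a (rfl | ⟨a, ha, rfl⟩)
    · exact Or.inl rfl
    · exact Or.inr ⟨inv a, hUinv a ha, rfl⟩
  have key : ∀ f f' : S, f * f = f → f' * f' = f' → (geJrel U f f' ↔
      ∃ u ∈ Uone U, invOne inv u * (f : WithOne S) * u = (f' : WithOne S)) := by
    intro f f' hf hf'
    constructor
    · rintro ⟨p, hp, q, hq, hpq⟩
      exact ⟨_, hm _ (hm _ hq _ (hi _ hq)) _ (hi _ hp),
        InvMon.part1 h (congrArg WithOne.coe hf) (congrArg WithOne.coe hf') hpq⟩
    · rintro ⟨u, hu, huf⟩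
      exact ⟨_, hi _ hu, u, hu, huf.symm⟩
  refine ⟨key e e' he he', fun hfin => ?_⟩
  constructor
  · rintro ⟨h1, h2⟩
    obtain ⟨u, hu, hue⟩ := (key e e' he he').1 h1
    obtain ⟨v, _, hve⟩ := (key e' e he' he).1 h2
    have : Finite (WithOne S) := inferInstanceAs (Finite (Option S))
    exact ⟨u, hu, hue, InvMon.part2 h (congrArg WithOne.coe he) hue hve⟩
  · rintro ⟨u, hu, h1, h2⟩
    exact ⟨⟨_, hi _ hu, u, hu, h1.symm⟩, ⟨u, hu, _, hi _ hu, h2.symm⟩⟩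
end

section
/- Let E be a finite semilattice generated by a subset Σ ⊆ E. If e ∈ E is written as e = e₁ e₂ ⋯ e_n with e₁, …, e_n ∈ Σ and n minimal among all such factorizations, then |E| ≥ 2ⁿ − 1. Consequently, every element of E is computed by a straight-line program over Σ of length at most 2·log₂(|E| + 1). -/
/-- `fwd s n = s 0 * s 1 * ⋯ * s n` (left-associated product of the first `n+1` terms). -/
def fwd {S : Type*} [Mul S] (s : ℕ → S) : ℕ → S
  | 0 => s 0
  | k + 1 => fwd s k * s (k + 1)

/-- `l` is a straight-line program over `Sg` in the semigroup `E`: every entry is either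
an element of `Sg` or the product of two earlier entries. -/
def IsSLPsg {E : Type*} [Mul E] (Sg : Set E) (l : List E) : Prop :=
  ∀ i : Fin l.length,
    l.get i ∈ Sg ∨
    (∃ j k : Fin l.length, (j : ℕ) < (i : ℕ) ∧ (k : ℕ) < (i : ℕ) ∧ l.get j * l.get k = l.get i)

theorem fwd_congr_aux {S : Type*} [Mul S] (s t : ℕ → S) (n : ℕ) (h : ∀ i ≤ n, s i = t i) :
    fwd s n = fwd t n := by
  induction n with
  | zero => exact h 0 le_rfl
  | succ k ih =>
    simp only [fwd]
    rw [ih (fun i hi => h i (by omega)), h (k + 1) le_rfl]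

theorem fwd_snoc_aux {S : Type*} [Mul S] (Sg : Set S) (g : ℕ → S) (m : ℕ) (a : S)
    (hg : ∀ i ≤ m, g i ∈ Sg) (ha : a ∈ Sg) :
    ∃ g' : ℕ → S, (∀ i ≤ m + 1, g' i ∈ Sg) ∧ fwd g' (m + 1) = fwd g m * a := by
  refine ⟨fun i => if i ≤ m then g i else a, ?_, ?_⟩
  · intro i _
    by_cases h : i ≤ m
    · simpa [h] using hg i h
    · simpa [h] using ha
  · simp only [fwd]
    rw [fwd_congr_aux (fun i => if i ≤ m then g i else a) g m (fun i hi => by simp [hi])]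
    simp

theorem fwd_mul_aux {S : Type*} [Semigroup S] (Sg : Set S) (f : ℕ → S) (n : ℕ)
    (hf : ∀ i ≤ n, f i ∈ Sg) (g : ℕ → S) (m : ℕ) (hg : ∀ i ≤ m, g i ∈ Sg) :
    ∃ (k : ℕ) (h : ℕ → S), (∀ i ≤ k, h i ∈ Sg) ∧ fwd f n * fwd g m = fwd h k := by
  induction m with
  | zero =>
    obtain ⟨g', h1, h2⟩ := fwd_snoc_aux Sg f n (g 0) hf (hg 0 le_rfl)
    exact ⟨n + 1, g', h1, h2.symm⟩
  | succ m ih =>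
    obtain ⟨k, h, h1, h2⟩ := ih (fun i hi => hg i (by omega))
    obtain ⟨g', h3, h4⟩ := fwd_snoc_aux Sg h k (g (m + 1)) h1 (hg _ le_rfl)
    refine ⟨k + 1, g', h3, ?_⟩
    rw [h4, ← h2, mul_assoc]
    rfl

theorem exists_fwd_aux {S : Type*} [Semigroup S] (Sg : Set S)
    (hgen : Subsemigroup.closure Sg = ⊤) (e : S) :
    ∃ (k : ℕ) (h : ℕ → S), (∀ i ≤ k, h i ∈ Sg) ∧ e = fwd h k := by
  have he : e ∈ Subsemigroup.closure Sg := by rw [hgen]; trivial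
  induction he using Subsemigroup.closure_induction with
  | mem x hx => exact ⟨0, fun _ => x, fun _ _ => hx, rfl⟩
  | mul x y _ _ hx hy =>
    obtain ⟨n, f, hf, rfl⟩ := hx
    obtain ⟨m, g, hg, rfl⟩ := hy
    exact fwd_mul_aux Sg f n hf g m hg

theorem slp_snoc_aux {E : Type*} [Mul E] (Sg : Set E) (l : List E) (a : E) (hl : IsSLPsg Sg l)
    (ha : a ∈ Sg ∨ ∃ x ∈ l, ∃ y ∈ l, x * y = a) : IsSLPsg Sg (l ++ [a]) := by
  rintro ⟨i, hi⟩
  have hi' : i < l.length + 1 := by simpa using hi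
  by_cases h : i < l.length
  · rcases hl ⟨i, h⟩ with h1 | ⟨j, k, hj, hk, h1⟩
    · left
      simpa [List.getElem_append_left h] using h1
    · right
      refine ⟨⟨j, by simp⟩, ⟨k, by simp⟩, hj, hk, ?_⟩
      simpa [List.getElem_append_left h] using h1
  · obtain rfl : i = l.length := by omega
    rcases ha with h1 | ⟨x, hx, y, hy, h1⟩
    · left
      simpa using h1
    · right
      obtain ⟨j, hj, rfl⟩ := List.getElem_of_mem hx
      obtain ⟨k, hk, rfl⟩ := List.getElem_of_mem hy
      refine ⟨⟨j, by simp; omega⟩, ⟨k, by simp; omega⟩, hj, hk, ?_⟩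
      simpa [List.getElem_append_left hj, List.getElem_append_left hk] using h1

theorem slp_fwd_aux {E : Type*} [Mul E] (Sg : Set E) (f : ℕ → E) (n : ℕ)
    (hf : ∀ i ≤ n, f i ∈ Sg) :
    ∃ l : List E, IsSLPsg Sg l ∧ fwd f n ∈ l ∧ l.length = 2 * n + 1 := by
  induction n with
  | zero =>
    refine ⟨[] ++ [f 0], slp_snoc_aux Sg [] (f 0) (fun i => i.elim0) (Or.inl (hf 0 le_rfl)), ?_, ?_⟩
    · simp [fwd]
    · simp
  | succ n ih =>
    obtain ⟨l, h1, h2, h3⟩ := ih (fun i hi => hf i (by omega))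
    refine ⟨(l ++ [f (n + 1)]) ++ [fwd f (n + 1)], ?_, by simp, by simp; omega⟩
    apply slp_snoc_aux
    · exact slp_snoc_aux _ _ _ h1 (Or.inl (hf _ le_rfl))
    · exact Or.inr ⟨fwd f n, by simp [h2], f (n + 1), by simp, rfl⟩

theorem prod_fwd_aux {E : Type*} [CommSemigroup E] (f : ℕ → E) (n : ℕ) :
    ∏ i ∈ Finset.range (n + 1), (f i : WithOne E) = (fwd f n : E) := by
  induction n with
  | zero => simp [fwd]
  | succ n ih => rw [Finset.prod_range_succ, ih, ← WithOne.coe_mul]; rfl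

theorem fwd_of_prod_aux {E : Type*} [CommSemigroup E] (Sg : Set E) (f : ℕ → E) (S : Finset ℕ)
    (hS : S.Nonempty) (hf : ∀ i ∈ S, f i ∈ Sg) :
    ∃ (m : ℕ) (g : ℕ → E), m + 1 = S.card ∧ (∀ i ≤ m, g i ∈ Sg) ∧
      ∏ i ∈ S, (f i : WithOne E) = (fwd g m : E) := by
  induction hS using Finset.Nonempty.cons_induction with
  | singleton a => exact ⟨0, fun _ => f a, by simp, fun _ _ => hf a (by simp), by simp [fwd]⟩
  | cons a s ha hs ih =>
    obtain ⟨m, g, h1, h2, h3⟩ := ih (fun i hi => hf i (by simp [hi]))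
    obtain ⟨g', h4, h5⟩ := fwd_snoc_aux Sg g m (f a) h2 (hf a (by simp))
    refine ⟨m + 1, g', by rw [Finset.card_cons, h1], h4, ?_⟩
    rw [Finset.prod_cons, h3, h5, WithOne.coe_mul, mul_comm]

theorem card_aux {E : Type*} [CommSemigroup E] [Fintype E] (hidem : ∀ x : E, x * x = x)
    (Sg : Set E) (e : E) (n : ℕ) (f : ℕ → E) (hf : ∀ i ≤ n, f i ∈ Sg) (he : e = fwd f n)
    (hmin : ∀ (m : ℕ) (g : ℕ → E), (∀ i ≤ m, g i ∈ Sg) → e = fwd g m → n ≤ m) :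
    2 ^ (n + 1) ≤ Fintype.card E + 1 := by
  classical
  have hfi : ∀ i, (f i : WithOne E) * f i = f i := fun i => by
    rw [← WithOne.coe_mul, hidem]
  -- no element can be dropped
  have key : ∀ T ⊆ Finset.range (n + 1), ∀ i ∈ Finset.range (n + 1), i ∉ T →
      (∏ j ∈ T, (f j : WithOne E)) * f i ≠ ∏ j ∈ T, (f j : WithOne E) := by
    intro T hT i hi hiT h
    have h1 : ∏ j ∈ (Finset.range (n + 1)).erase i, (f j : WithOne E) = (e : E) := by
      rw [he, ← prod_fwd_aux, ← Finset.mul_prod_erase _ _ hi]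
      have hT' : T ⊆ (Finset.range (n + 1)).erase i := fun j hj =>
        Finset.mem_erase.2 ⟨fun hji => hiT (hji ▸ hj), hT hj⟩
      rw [← Finset.prod_sdiff hT', mul_comm, ← mul_assoc, mul_comm (f i : WithOne E), h]
    rcases Finset.eq_empty_or_nonempty ((Finset.range (n + 1)).erase i) with h2 | h2
    · rw [h2, Finset.prod_empty] at h1
      exact WithOne.one_ne_coe h1
    · obtain ⟨m, g, h3, h4, h5⟩ := fwd_of_prod_aux Sg f _ h2 (fun j hj => hf j (by
        have := Finset.mem_range.1 (Finset.mem_of_mem_erase hj); omega))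
      have h6 := hmin m g h4 (WithOne.coe_injective (h1.symm.trans h5))
      rw [Finset.card_erase_of_mem hi, Finset.card_range] at h3
      omega
  have absorb : ∀ (S : Finset ℕ), ∀ i ∈ S,
      (∏ j ∈ S, (f j : WithOne E)) * f i = ∏ j ∈ S, (f j : WithOne E) := by
    intro S i hi
    rw [← Finset.mul_prod_erase _ _ hi, mul_right_comm, hfi]
  have sub : ∀ S ⊆ Finset.range (n + 1), ∀ T ⊆ Finset.range (n + 1),
      ∏ j ∈ S, (f j : WithOne E) = ∏ j ∈ T, (f j : WithOne E) → S ⊆ T := by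
    intro S hS T hT h i hi
    by_contra hiT
    exact key T hT i (hS hi) hiT (by rw [← h]; exact absorb S i hi)
  letI : Fintype (WithOne E) := inferInstanceAs (Fintype (Option E))
  have hc : Fintype.card (WithOne E) = Fintype.card E + 1 := Fintype.card_option
  rw [← hc, ← Finset.card_range (n + 1), ← Finset.card_powerset, ← Finset.card_univ]
  apply Finset.card_le_card_of_injOn (fun S => ∏ j ∈ S, (f j : WithOne E))
  · intro _ _; simp
  · intro S hS T hT h
    have hS' := Finset.mem_powerset.1 (Finset.mem_coe.1 hS)
    have hT' := Finset.mem_powerset.1 (Finset.mem_coe.1 hT)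
    exact (sub S hS' T hT' h).antisymm (sub T hT' S hS' h.symm)

/-- **Statement 7.** Let `E` be a finite semilattice generated by `Sg ⊆ E`.  If `e ∈ E`
is written as `e = e₀ e₁ ⋯ e_n` with all `e_i ∈ Sg` and `n+1` minimal among all such
factorizations, then `|E| ≥ 2^(n+1) − 1`.  Consequently, every element of `E` is computed
by a straight-line program over `Sg` of length at most `2·log₂(|E| + 1)`. -/
theorem stmt_7 {E : Type*} [Semigroup E] [Fintype E]
    (hcomm : ∀ x y : E, x * y = y * x) (hidem : ∀ x : E, x * x = x)
    (Sg : Set E) (hgen : Subsemigroup.closure Sg = ⊤) :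
    (∀ (e : E) (n : ℕ) (f : ℕ → E),
        (∀ i ≤ n, f i ∈ Sg) → e = fwd f n →
        (∀ (m : ℕ) (g : ℕ → E), (∀ i ≤ m, g i ∈ Sg) → e = fwd g m → n ≤ m) →
        2 ^ (n + 1) - 1 ≤ Fintype.card E) ∧
    (∀ e : E, ∃ l : List E, IsSLPsg Sg l ∧ e ∈ l ∧
        (l.length : ℝ) ≤ 2 * Real.logb 2 (Fintype.card E + 1)) := by
  have A : ∀ (e : E) (n : ℕ) (f : ℕ → E),
        (∀ i ≤ n, f i ∈ Sg) → e = fwd f n →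
        (∀ (m : ℕ) (g : ℕ → E), (∀ i ≤ m, g i ∈ Sg) → e = fwd g m → n ≤ m) →
        2 ^ (n + 1) ≤ Fintype.card E + 1 := by
    intro e n f h1 h2 h3
    letI : CommSemigroup E := { ‹Semigroup E› with mul_comm := hcomm }
    exact card_aux hidem Sg e n f h1 h2 h3
  refine ⟨fun e n f h1 h2 h3 => Nat.sub_le_of_le_add (A e n f h1 h2 h3), fun e => ?_⟩
  classical
  have hex := exists_fwd_aux Sg hgen e
  obtain ⟨f, hf, he⟩ := Nat.find_spec hex
  have hA := A e _ f hf he (fun m g hg hm => Nat.find_min' hex ⟨g, hg, hm⟩)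
  obtain ⟨l, hl, hel, hlen⟩ := slp_fwd_aux Sg f _ hf
  refine ⟨l, hl, he ▸ hel, ?_⟩
  generalize Nat.find hex = n at *
  have hlog : ((n + 1 : ℕ) : ℝ) ≤ Real.logb 2 (Fintype.card E + 1) := by
    rw [Real.le_logb_iff_rpow_le (by norm_num) (by positivity), Real.rpow_natCast]
    exact_mod_cast hA
  rw [hlen]
  push_cast at hlog ⊢
  linarith
end

section
/- There exists a constant C > 0 such that for every finite Clifford semigroup S and every generating set Σ ⊆ S (as an inverse semigroup), every element t ∈ S is computed by a straight-line program over Σ of length at most C·(1 + log₂|S|)². -/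
/-- The inverse subsemigroup generated by `X`: the smallest subset containing `X`
that is closed under multiplication and under the inverse operation `inv`. -/
def invClosureA {S : Type*} [Mul S] (inv : S → S) (X : Set S) : Set S :=
  ⋂₀ {V : Set S | X ⊆ V ∧ (∀ a ∈ V, ∀ b ∈ V, a * b ∈ V) ∧ ∀ a ∈ V, inv a ∈ V}

/-- `l` is a straight-line program over `Sg` in the inverse semigroup `S` (with inverse
operation `inv`): every entry is either an element of `Sg`, or the product of two earlier
entries, or the inverse of an earlier entry. -/
def IsSLPinv {S : Type*} [Mul S] (inv : S → S) (Sg : Set S) (l : List S) : Prop :=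
  ∀ i : Fin l.length,
    l.get i ∈ Sg ∨
    (∃ j k : Fin l.length, (j : ℕ) < (i : ℕ) ∧ (k : ℕ) < (i : ℕ) ∧ l.get j * l.get k = l.get i) ∨
    (∃ j : Fin l.length, (j : ℕ) < (i : ℕ) ∧ inv (l.get j) = l.get i)

theorem isSLPinv_append {S : Type*} [Mul S] (inv : S → S) (Sg : Set S) (l : List S) (x : S)
    (h : IsSLPinv inv Sg l)
    (hx : x ∈ Sg ∨ (∃ a ∈ l, ∃ b ∈ l, a * b = x) ∨ (∃ a ∈ l, inv a = x)) :
    IsSLPinv inv Sg (l ++ [x]) := by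
  rintro ⟨i, hi⟩
  have hlen : (l ++ [x]).length = l.length + 1 := by simp
  by_cases hil : i < l.length
  · have e : ∀ j (hj : j < l.length), (l ++ [x]).get ⟨j, by omega⟩ = l.get ⟨j, hj⟩ := by
      intro j hj
      simp [List.getElem_append, hj]
    rw [e i hil]
    rcases h ⟨i, hil⟩ with h1 | ⟨j, k, hj, hk, h2⟩ | ⟨j, hj, h2⟩
    · exact Or.inl h1
    · refine Or.inr (Or.inl ⟨⟨j, by omega⟩, ⟨k, by omega⟩, hj, hk, ?_⟩)
      rw [e j j.2, e k k.2]; exact h2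
    · refine Or.inr (Or.inr ⟨⟨j, by omega⟩, hj, ?_⟩)
      rw [e j j.2]; exact h2
  · have hi' : i = l.length := by omega
    subst hi'
    have e0 : (l ++ [x]).get ⟨l.length, hi⟩ = x := by simp
    have e : ∀ j (hj : j < l.length), (l ++ [x]).get ⟨j, by omega⟩ = l.get ⟨j, hj⟩ := by
      intro j hj
      simp [List.getElem_append, hj]
    rw [e0]
    rcases hx with h1 | ⟨a, ha, b, hb, h2⟩ | ⟨a, ha, h2⟩
    · exact Or.inl h1
    · obtain ⟨j, rfl⟩ := List.get_of_mem ha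
      obtain ⟨k, rfl⟩ := List.get_of_mem hb
      refine Or.inr (Or.inl ⟨⟨j, by omega⟩, ⟨k, by omega⟩, j.2, k.2, ?_⟩)
      rw [e j j.2, e k k.2]; exact h2
    · obtain ⟨j, rfl⟩ := List.get_of_mem ha
      refine Or.inr (Or.inr ⟨⟨j, by omega⟩, j.2, ?_⟩)
      rw [e j j.2]; exact h2

/-- All of `X` is computed by an SLP of length at most `n`. -/
def CompBy {S : Type*} [Mul S] (inv : S → S) (Sg : Set S) (n : ℕ) (X : Set S) : Prop :=
  ∃ l : List S, IsSLPinv inv Sg l ∧ l.length ≤ n ∧ ∀ x ∈ X, x ∈ l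

namespace CompBy
variable {S : Type*} [Mul S] {inv : S → S} {Sg : Set S} {n : ℕ} {X : Set S}

theorem empty : CompBy inv Sg 0 ∅ :=
  ⟨[], fun i => i.elim0, le_rfl, fun _ h => h.elim⟩

theorem mono (h : CompBy inv Sg n X) {m : ℕ} {Y : Set S} (hm : n ≤ m) (hY : Y ⊆ X) :
    CompBy inv Sg m Y := by
  obtain ⟨l, h1, h2, h3⟩ := h
  exact ⟨l, h1, h2.trans hm, fun x hx => h3 x (hY hx)⟩

theorem step (h : CompBy inv Sg n X) (x : S)
    (hx : x ∈ Sg ∨ (∃ a ∈ X, ∃ b ∈ X, a * b = x) ∨ (∃ a ∈ X, inv a = x)) :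
    CompBy inv Sg (n + 1) (insert x X) := by
  obtain ⟨l, h1, h2, h3⟩ := h
  refine ⟨l ++ [x], isSLPinv_append inv Sg l x h1 ?_, by simpa using h2, ?_⟩
  · rcases hx with h | ⟨a, ha, b, hb, h⟩ | ⟨a, ha, h⟩
    · exact Or.inl h
    · exact Or.inr (Or.inl ⟨a, h3 a ha, b, h3 b hb, h⟩)
    · exact Or.inr (Or.inr ⟨a, h3 a ha, h⟩)
  · rintro y (rfl | hy)
    · simp
    · simp [h3 y hy]

theorem gen (h : CompBy inv Sg n X) {x : S} (hx : x ∈ Sg) :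
    CompBy inv Sg (n + 1) (insert x X) := h.step x (Or.inl hx)

theorem mul (h : CompBy inv Sg n X) {a b : S} (ha : a ∈ X) (hb : b ∈ X) :
    CompBy inv Sg (n + 1) (insert (a * b) X) := h.step _ (Or.inr (Or.inl ⟨a, ha, b, hb, rfl⟩))

theorem invs (h : CompBy inv Sg n X) {a : S} (ha : a ∈ X) :
    CompBy inv Sg (n + 1) (insert (inv a) X) := h.step _ (Or.inr (Or.inr ⟨a, ha, rfl⟩))
end CompBy

theorem irredundant_card {ι M : Type*} [DecidableEq ι] [CommMonoid M] [Fintype M]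
    (hM : ∀ x : M, x * x = x) (f : ι → M) (A : Finset ι) :
    ∃ B ⊆ A, ∏ i ∈ B, f i = ∏ i ∈ A, f i ∧ 2 ^ B.card ≤ Fintype.card M := by
  classical
  have habs : ∀ U V : Finset ι, (∏ i ∈ U ∪ V, f i) = (∏ i ∈ U, f i) * ∏ i ∈ V, f i := by
    intro U V
    induction V using Finset.induction_on with
    | empty => simp
    | insert a V ha ih =>
      rw [Finset.prod_insert ha, Finset.union_insert]
      by_cases hU : a ∈ U ∪ V
      · rw [Finset.insert_eq_of_mem hU, mul_left_comm, ← ih]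
        rw [← Finset.mul_prod_erase _ f hU, ← mul_assoc, hM]
      · rw [Finset.prod_insert hU, ih, mul_left_comm]
  let F := A.powerset.filter (fun B => ∏ i ∈ B, f i = ∏ i ∈ A, f i)
  have hF : F.Nonempty := ⟨A, by simp [F]⟩
  obtain ⟨B, hB, hmin⟩ := Finset.exists_min_image F Finset.card hF
  simp only [F, Finset.mem_filter, Finset.mem_powerset] at hB hmin
  refine ⟨B, hB.1, hB.2, ?_⟩
  have key : ∀ U ⊆ B, ∀ V ⊆ B, ∏ i ∈ U, f i = ∏ i ∈ V, f i → U ⊆ V := by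
    intro U hU V hV h a ha
    by_contra hav
    have haB := hU ha
    have h1 : B.erase a ∪ V = B.erase a := by
      apply Finset.union_eq_left.2
      intro x hx
      exact Finset.mem_erase.2 ⟨fun h => hav (h ▸ hx), hV hx⟩
    have h2 : B.erase a ∪ U = B := by
      ext x
      simp only [Finset.mem_union, Finset.mem_erase]
      constructor
      · rintro (h | h)
        · exact h.2
        · exact hU h
      · intro h
        by_cases hx : x = a
        · right; rw [hx]; exact ha
        · left; exact ⟨hx, h⟩
    have h3 : ∏ i ∈ B.erase a, f i = ∏ i ∈ B, f i := by
      calc _ = ∏ i ∈ B.erase a ∪ V, f i := by rw [h1]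
        _ = ∏ i ∈ B.erase a ∪ U, f i := by rw [habs, habs, h]
        _ = _ := by rw [h2]
    have h4 := hmin (B.erase a) ⟨(Finset.erase_subset _ _).trans hB.1, h3.trans hB.2⟩
    have := Finset.card_erase_lt_of_mem haB
    omega
  rw [← Finset.card_powerset, ← Finset.card_univ]
  apply Finset.card_le_card_of_injOn (fun U => ∏ i ∈ U, f i)
  · intro x _; simp
  · intro U hU V hV h
    simp only [Finset.coe_powerset, Set.mem_preimage, Set.mem_powerset_iff, Finset.coe_subset] at hU hV
    exact Finset.Subset.antisymm (key U hU V hV h) (key V hV U hU h.symm)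

/-- Clifford semigroup axioms. -/
structure IsCliff {S : Type*} [Semigroup S] (inv : S → S) : Prop where
  h1 : ∀ x : S, x * inv x * x = x
  h2 : ∀ x : S, inv x * x * inv x = inv x
  h3 : ∀ x y : S, x * y * x = x → y * x * y = y → y = inv x
  h4 : ∀ x : S, x * inv x = inv x * x

namespace IsCliff
variable {S : Type*} [Semigroup S] {inv : S → S}

theorem inv_inv (H : IsCliff inv) (x : S) : inv (inv x) = x := (H.h3 _ _ (H.h2 x) (H.h1 x)).symm

theorem idem_mul (H : IsCliff inv) {e f : S} (he : e * e = e) (hf : f * f = f) : (e * f) * (e * f) = e * f := by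
  have a1 := H.h1 (e * f)
  have a2 := H.h2 (e * f)
  set z := inv (e * f) with hz
  have hfz : f * z * e = z := by
    apply H.h3
    · calc e * f * (f * z * e) * (e * f) = e * (f * f) * z * ((e * e) * f) := by simp only [mul_assoc]
        _ = e * f := by rw [he, hf, a1]
    · calc f * z * e * (e * f) * (f * z * e) = f * (z * ((e * e) * (f * f)) * z) * e := by
            simp only [mul_assoc]
        _ = f * z * e := by rw [he, hf, a2]
  have hzz : z * z = z := by
    calc z * z = f * z * e * (f * z * e) := by rw [hfz]
      _ = f * (z * (e * f) * z) * e := by simp only [mul_assoc]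
      _ = z := by rw [a2, hfz]
  have h5 : z = inv z := H.h3 z z (by rw [hzz, hzz]) (by rw [hzz, hzz])
  have h6 : e * f = inv z := H.h3 z (e * f) a2 a1
  rw [h6, ← h5, hzz]

theorem idem_comm (H : IsCliff inv) {e f : S} (he : e * e = e) (hf : f * f = f) : e * f = f * e := by
  have a := H.idem_mul he hf
  have b := H.idem_mul hf he
  have c1 : e * f = inv (e * f) := H.h3 _ _ (by rw [a, a]) (by rw [a, a])
  have c2 : f * e = inv (e * f) := by
    apply H.h3
    · calc e * f * (f * e) * (e * f) = e * (f * f) * ((e * e) * f) := by simp only [mul_assoc]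
        _ = e * f := by rw [he, hf, a]
    · calc f * e * (e * f) * (f * e) = f * (e * e) * ((f * f) * e) := by simp only [mul_assoc]
        _ = f * e := by rw [he, hf, b]
  rw [c1, ← c2]

theorem eps_idem (H : IsCliff inv) (x : S) : (x * inv x) * (x * inv x) = x * inv x := by
  rw [← mul_assoc, H.h1]

theorem eps_idem' (H : IsCliff inv) (x : S) : (inv x * x) * (inv x * x) = inv x * x := by
  rw [← mul_assoc, H.h2]

theorem inv_mul (H : IsCliff inv) (a b : S) : inv (a * b) = inv b * inv a := by
  symm
  have hc := H.idem_comm (H.eps_idem' a) (H.eps_idem b)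
  apply H.h3
  · calc a * b * (inv b * inv a) * (a * b) = a * ((b * inv b) * (inv a * a)) * b := by
          simp only [mul_assoc]
      _ = (a * inv a * a) * (b * inv b * b) := by rw [← hc]; simp only [mul_assoc]
      _ = a * b := by rw [H.h1, H.h1]
  · calc inv b * inv a * (a * b) * (inv b * inv a) = inv b * ((inv a * a) * (b * inv b)) * inv a := by
          simp only [mul_assoc]
      _ = (inv b * b * inv b) * (inv a * a * inv a) := by rw [hc]; simp only [mul_assoc]
      _ = _ := by rw [H.h2, H.h2]

theorem central (H : IsCliff inv) {e : S} (he : e * e = e) (x : S) : e * x = x * e := by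
  have hie : inv e = e := (H.h3 e e (by rw [he, he]) (by rw [he, he])).symm
  have h := H.h4 (e * x)
  rw [H.inv_mul, hie] at h
  have hc := H.idem_comm he (H.eps_idem x)
  have hc' := H.idem_comm he (H.eps_idem' x)
  have h' : e * (x * inv x) = inv x * e * x := by
    calc e * (x * inv x) = (e * e) * (x * inv x) := by rw [he]
      _ = e * (e * (x * inv x)) := by rw [mul_assoc]
      _ = e * ((x * inv x) * e) := by rw [hc]
      _ = e * x * (inv x * e) := by simp only [mul_assoc]
      _ = inv x * e * (e * x) := h
      _ = inv x * (e * e) * x := by simp only [mul_assoc]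
      _ = _ := by rw [he]
  calc e * x = e * (x * inv x * x) := by rw [H.h1]
    _ = (e * (x * inv x)) * x := by simp only [mul_assoc]
    _ = x * inv x * e * x := by rw [hc]
    _ = x * (inv x * e * x) := by simp only [mul_assoc]
    _ = x * (e * (x * inv x)) := by rw [h']
    _ = x * (e * (inv x * x)) := by rw [H.h4]
    _ = x * ((inv x * x) * e) := by rw [hc']
    _ = (x * inv x * x) * e := by simp only [mul_assoc]
    _ = x * e := by rw [H.h1]

theorem eps_mul (H : IsCliff inv) (a b : S) : (a * b) * inv (a * b) = (a * inv a) * (b * inv b) := by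
  rw [H.inv_mul]
  calc a * b * (inv b * inv a) = a * ((b * inv b) * inv a) := by simp only [mul_assoc]
    _ = a * (inv a * (b * inv b)) := by rw [H.central (H.eps_idem b)]
    _ = _ := by simp only [mul_assoc]

theorem eps_inv (H : IsCliff inv) (a : S) : inv a * inv (inv a) = a * inv a := by
  rw [H.inv_inv, H.h4]

/-- `D` closed under generators above `e` is closed under all elements above `e`. -/
theorem closed_all (H : IsCliff inv) {Sg : Set S} (hS : invClosureA inv Sg = Set.univ) (e : S)
    (he : e * e = e) (D : Set S)
    (hD : ∀ s ∈ Sg, e * (s * inv s) = e → ∀ x ∈ D, x * s ∈ D ∧ x * inv s ∈ D) :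
    ∀ t, e * (t * inv t) = e → ∀ x ∈ D, x * t ∈ D := by
  have hV : ∀ t ∈ invClosureA inv Sg,
      e * (t * inv t) = e → ∀ x ∈ D, x * t ∈ D ∧ x * inv t ∈ D := by
    intro t ht
    refine Set.mem_sInter.1 ht {t | e * (t * inv t) = e → ∀ x ∈ D, x * t ∈ D ∧ x * inv t ∈ D}
      ⟨hD, ?_, ?_⟩
    · intro a ha b hb hab x hx
      rw [H.eps_mul] at hab
      have hb' : e * (b * inv b) = e := by
        rw [← hab]
        simp only [mul_assoc]
        congr 3
        have := H.eps_idem b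
        simpa only [mul_assoc] using this
      have ha' : e * (a * inv a) = e := by
        rw [H.idem_comm (H.eps_idem a) (H.eps_idem b), ← mul_assoc, hb'] at hab
        exact hab
      refine ⟨?_, ?_⟩
      · rw [← mul_assoc]
        exact (hb hb' _ (ha ha' x hx).1).1
      · rw [H.inv_mul, ← mul_assoc]
        exact (ha ha' _ (hb hb' x hx).2).2
    · intro a ha h x hx
      rw [H.eps_inv] at h
      rw [H.inv_inv]
      exact (ha h x hx).symm
  intro t ht x hx
  exact (hV t (hS ▸ Set.mem_univ t) ht x hx).1

end IsCliff

/-- The commutative semigroup of idempotents. -/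
def Idem (S : Type*) [Mul S] : Type _ := {x : S // x * x = x}

/-- Idempotents of a Clifford semigroup form a commutative semigroup. -/
@[reducible] def IsCliff.idemComm {S : Type*} [Semigroup S] {inv : S → S} (H : IsCliff inv) :
    CommSemigroup (Idem S) where
  mul a b := ⟨a.1 * b.1, H.idem_mul a.2 b.2⟩
  mul_assoc a b c := Subtype.ext (mul_assoc a.1 b.1 c.1)
  mul_comm a b := Subtype.ext (H.idem_comm a.2 b.2)

theorem IsCliff.comp_idem {S : Type*} [Semigroup S] [Fintype S] {inv : S → S} (H : IsCliff inv)
    {Sg : Set S} (hS : invClosureA inv Sg = Set.univ) (t : S) :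
    ∃ k : ℕ, 2 ^ k ≤ Fintype.card S + 1 ∧ CompBy inv Sg (4 * k) {t * inv t} := by
  classical
  let := H.idemComm
  have hfin : Finite (Idem S) := inferInstanceAs (Finite {x : S // x * x = x})
  let : Fintype (Idem S) := Fintype.ofFinite _
  let : Fintype (WithOne (Idem S)) := inferInstanceAs (Fintype (Option (Idem S)))
  have hcard : Fintype.card (WithOne (Idem S)) ≤ Fintype.card S + 1 := by
    have h1 : Fintype.card (WithOne (Idem S)) = Fintype.card (Idem S) + 1 :=
      Fintype.card_option (α := Idem S)
    have h2 : Fintype.card (Idem S) ≤ Fintype.card S :=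
      Fintype.card_le_of_injective (fun x : Idem S => x.1) Subtype.val_injective
    omega
  let ε : S → Idem S := fun s => ⟨s * inv s, H.eps_idem s⟩
  let f : S → WithOne (Idem S) := fun s => (ε s : WithOne (Idem S))
  have hM : ∀ x : WithOne (Idem S), x * x = x := by
    intro x
    induction x using WithOne.cases_on
    · simp
    · intro a
      rw [← WithOne.coe_mul]
      congr 1
      exact Subtype.ext a.2
  have hmul : ∀ a b, f (a * b) = f a * f b := by
    intro a b
    change ((ε (a * b) : Idem S) : WithOne (Idem S)) = (ε a : WithOne (Idem S)) * (ε b : WithOne (Idem S))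
    rw [← WithOne.coe_mul]
    congr 1
    exact Subtype.ext (H.eps_mul a b)
  have hinv : ∀ a, f (inv a) = f a := by
    intro a
    change ((ε (inv a) : Idem S) : WithOne (Idem S)) = (ε a : WithOne (Idem S))
    congr 1
    exact Subtype.ext (H.eps_inv a)
  have habs : ∀ U V : Finset S, (∏ i ∈ U ∪ V, f i) = (∏ i ∈ U, f i) * ∏ i ∈ V, f i := by
    intro U V
    induction V using Finset.induction_on with
    | empty => simp
    | insert a V ha ih =>
      rw [Finset.prod_insert ha, Finset.union_insert]
      by_cases hU : a ∈ U ∪ V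
      · rw [Finset.insert_eq_of_mem hU, mul_left_comm, ← ih]
        rw [← Finset.mul_prod_erase _ f hU, ← mul_assoc, hM]
      · rw [Finset.prod_insert hU, ih, mul_left_comm]
  have hA : ∃ A : Finset S, (A : Set S) ⊆ Sg ∧ ∏ i ∈ A, f i = f t := by
    have ht : t ∈ invClosureA inv Sg := hS ▸ Set.mem_univ t
    refine Set.mem_sInter.1 ht {t | ∃ A : Finset S, (A : Set S) ⊆ Sg ∧ ∏ i ∈ A, f i = f t}
      ⟨?_, ?_, ?_⟩
    · intro s hs
      exact ⟨{s}, by simpa using hs, by simp⟩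
    · rintro a ⟨A, hA, hA'⟩ b ⟨B, hB, hB'⟩
      refine ⟨A ∪ B, by simp [hA, hB], ?_⟩
      rw [habs, hA', hB', hmul]
    · rintro a ⟨A, hA, hA'⟩
      exact ⟨A, hA, by rw [hA', hinv]⟩
  obtain ⟨A, hASg, hA⟩ := hA
  obtain ⟨B, hBA, hB, hB2⟩ := irredundant_card hM f A
  refine ⟨B.card, hB2.trans hcard, ?_⟩
  have main : ∀ B : Finset S, (B : Set S) ⊆ Sg →
      (∏ i ∈ B, f i = 1 ∨ ∃ x : Idem S, ∏ i ∈ B, f i = (x : WithOne (Idem S)) ∧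
        CompBy inv Sg (4 * B.card) {x.1}) := by
    intro B
    induction B using Finset.induction_on with
    | empty => intro _; left; simp
    | insert a B ha ih =>
      intro hB
      have hB' : (B : Set S) ⊆ Sg := fun x hx => hB (by simp at hx; simp [hx])
      have haS : a ∈ Sg := hB (by simp)
      right
      rw [Finset.prod_insert ha, Finset.card_insert_of_notMem ha]
      rcases ih hB' with h | ⟨x, hx, hc⟩
      · refine ⟨ε a, by rw [h, mul_one], ?_⟩
        have c1 := ((CompBy.empty (inv := inv) (Sg := Sg)).gen haS).invs (a := a) (by simp)
        have c2 := c1.mul (a := a) (b := inv a) (by simp) (by simp)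
        exact c2.mono (by omega) (by simp [ε])
      · refine ⟨ε a * x, by rw [hx, WithOne.coe_mul], ?_⟩
        have c1 := (hc.gen haS).invs (a := a) (by simp)
        have c2 := c1.mul (a := a) (b := inv a) (by simp) (by simp)
        have c3 := c2.mul (a := a * inv a) (b := x.1) (by simp) (by simp)
        refine c3.mono (by omega) ?_
        rintro y rfl
        exact Or.inl rfl
  rcases main B (fun x hx => hASg (hBA hx)) with h | ⟨x, hx, hc⟩
  · exact absurd ((hB.trans hA).symm.trans h) WithOne.coe_ne_one
  · have h : (ε t : WithOne (Idem S)) = x := (hB.trans hA).symm.trans hx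
    have h' : ε t = x := WithOne.coe_inj.1 h
    rw [← h'] at hc
    exact hc

/-- State of the cube-doubling construction. -/
def CubeState {S : Type*} [Mul S] (inv : S → S) (Sg : Set S) (e : S) (n0 i : ℕ)
    (K : Finset S) : Prop :=
  (∀ k ∈ K, k * inv k = e) ∧ K.card = 2 ^ i ∧ ∃ X : Set S, e ∈ X ∧
    CompBy inv Sg (n0 + i ^ 2 + 6 * i) X ∧
    ∀ k ∈ K, ∀ m Y, X ⊆ Y → CompBy inv Sg m Y → CompBy inv Sg (m + i) (insert k Y)

theorem IsCliff.cube_step {S : Type*} [Semigroup S] {inv : S → S} (H : IsCliff inv)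
    {Sg : Set S} {e : S} {n0 i : ℕ} {K : Finset S} (hK : CubeState inv Sg e n0 i K)
    (he : e * e = e) {k k' : S} (hk : k ∈ K) (hk' : k' ∈ K) {s s' : S} (hs : s ∈ Sg)
    (hs' : s' = s ∨ s' = inv s) (hes : e * (s * inv s) = e)
    (hnot : ∀ a ∈ K, ∀ b ∈ K, inv k * k' * s' ≠ inv a * b) :
    ∃ K', CubeState inv Sg e n0 (i + 1) K' := by
  classical
  obtain ⟨h1, h2, X, heX, hc, hr⟩ := hK
  set y := inv k * k' * s' with hy
  have hes' : e * (s' * inv s') = e := by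
    rcases hs' with rfl | rfl
    · exact hes
    · rw [H.eps_inv]; exact hes
  have hye : y * inv y = e := by
    rw [hy, H.eps_mul, H.eps_mul, H.eps_inv, h1 k hk, h1 k' hk', he, hes']
  have hcy : CompBy inv Sg (n0 + (i + 1) ^ 2 + 6 * (i + 1)) (insert y X) := by
    have c1 := hr k hk _ X subset_rfl hc
    have c2 := c1.invs (a := k) (by simp)
    have c3 := hr k' hk' _ _ (by intro x hx; simp [hx]) c2
    have c4 := c3.mul (a := inv k) (b := k') (by simp) (by simp)
    have c5 := c4.gen hs
    have c6 := c5.invs (a := s) (by simp)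
    have c7 := c6.mul (a := inv k * k') (b := s') (by simp) (by rcases hs' with rfl | rfl <;> simp)
    refine c7.mono (by nlinarith) ?_
    rintro x (rfl | hx)
    · left; rfl
    · simp [hx]
  have hid : ∀ k ∈ K, k * e = k := by
    intro k hk
    rw [← h1 k hk, H.h4, ← mul_assoc, H.h1]
  have hinj : ∀ a ∈ K, ∀ b ∈ K, a * y = b * y → a = b := by
    intro a ha b hb hab
    calc a = a * (y * inv y) := by rw [hye, hid a ha]
      _ = a * y * inv y := (mul_assoc _ _ _).symm
      _ = b * y * inv y := by rw [hab]
      _ = b * (y * inv y) := mul_assoc _ _ _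
      _ = b := by rw [hye, hid b hb]
  refine ⟨K ∪ K.image (fun k => k * y), ?_, ?_, insert y X, by simp [heX], hcy, ?_⟩
  · intro a ha
    rcases Finset.mem_union.1 ha with ha | ha
    · exact h1 a ha
    · obtain ⟨b, hb, rfl⟩ := Finset.mem_image.1 ha
      rw [H.eps_mul, h1 b hb, hye, he]
  · rw [Finset.card_union_of_disjoint, Finset.card_image_of_injOn, h2, pow_succ, mul_two]
    · intro a ha b hb hab
      exact hinj a ha b hb hab
    · rw [Finset.disjoint_left]
      intro a ha ha'
      obtain ⟨b, hb, hab⟩ := Finset.mem_image.1 ha'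
      apply hnot b hb a ha
      have hey : e * y = y := by rw [← hye, H.h1]
      rw [← hab, ← mul_assoc, ← H.h4, h1 b hb, hey]
  · intro a ha m Y hXY hY
    rcases Finset.mem_union.1 ha with ha | ha
    · exact (hr a ha m Y (fun x hx => hXY (by simp [hx])) hY).mono (by omega) subset_rfl
    · obtain ⟨b, hb, rfl⟩ := Finset.mem_image.1 ha
      have c1 := hr b hb m Y (fun x hx => hXY (by simp [hx])) hY
      have c2 := c1.mul (a := b) (b := y) (by simp) (Or.inr (hXY (by simp)))
      refine c2.mono (by omega) ?_
      rintro x (rfl | hx)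
      · left; rfl
      · simp [hx]

theorem IsCliff.comp_all {S : Type*} [Semigroup S] [Fintype S] {inv : S → S} (H : IsCliff inv)
    {Sg : Set S} (hS : invClosureA inv Sg = Set.univ) (t : S) :
    ∃ k i : ℕ, 2 ^ k ≤ Fintype.card S + 1 ∧ 2 ^ i ≤ Fintype.card S ∧
      CompBy inv Sg (4 * k + i ^ 2 + 8 * i + 2) {t} := by
  classical
  obtain ⟨k0, hk0, hc0⟩ := H.comp_idem hS t
  set e := t * inv t with he'
  have he : e * e = e := H.eps_idem t
  have hie : inv e = e := (H.h3 e e (by rw [he, he]) (by rw [he, he])).symm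
  let Q : ℕ → Prop := fun i => ∃ K, CubeState inv Sg e (4 * k0) i K
  have hQ0 : Q 0 := by
    refine ⟨{e}, ?_, by simp, {e}, by simp, hc0.mono (by omega) subset_rfl, ?_⟩
    · intro k hk
      rw [Finset.mem_singleton.1 hk, hie, he]
    · intro k hk m Y hY hc
      rw [Finset.mem_singleton.1 hk, Set.insert_eq_of_mem (hY rfl)]
      exact hc
  have hQb : ∀ i, Q i → 2 ^ i ≤ Fintype.card S := by
    rintro i ⟨K, -, h, -⟩
    rw [← h]; exact Finset.card_le_univ K
  have hmax : ∃ i, Q i ∧ ¬ Q (i + 1) := by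
    by_contra! hcon
    have hall : ∀ i, Q i := fun i => Nat.rec hQ0 (fun i hi => hcon i hi) i
    have := hQb _ (hall (Fintype.card S))
    exact absurd this (not_le.2 Nat.lt_two_pow_self)
  obtain ⟨i, ⟨K, hK⟩, hmax⟩ := hmax
  refine ⟨k0, i, hk0, hQb i ⟨K, hK⟩, ?_⟩
  have hclosed := H.closed_all hS e he {x | ∃ a ∈ K, ∃ b ∈ K, x = inv a * b} (by
    rintro s hs hes x ⟨k, hk, k', hk', rfl⟩
    constructor
    · by_contra hcon
      exact hmax (H.cube_step hK he hk hk' (s' := s) hs (Or.inl rfl) hes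
        (fun a ha b hb h => hcon ⟨a, ha, b, hb, h⟩))
    · by_contra hcon
      exact hmax (H.cube_step hK he hk hk' (s' := inv s) hs (Or.inr rfl) hes
        (fun a ha b hb h => hcon ⟨a, ha, b, hb, h⟩)))
  obtain ⟨h1, h2, X, heX, hc, hr⟩ := hK
  have hKne : K.Nonempty := by
    rw [← Finset.card_pos, h2]; positivity
  obtain ⟨a, ha⟩ := hKne
  have htD := hclosed t he e ⟨a, ha, a, ha, by rw [← H.h4, h1 a ha]⟩
  have het : e * t = t := H.h1 t
  rw [het] at htD
  obtain ⟨k, hk, k', hk', hkk⟩ := htD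
  have c1 := hr k hk _ X subset_rfl hc
  have c2 := c1.invs (a := k) (by simp)
  have c3 := hr k' hk' _ _ (by intro x hx; simp [hx]) c2
  have c4 := c3.mul (a := inv k) (b := k') (by simp) (by simp)
  refine c4.mono (by omega) ?_
  rintro x rfl
  left; exact hkk

/-- **Statement 8.** There is a constant `C > 0` such that for every finite Clifford
semigroup `S` and every generating set `Sg ⊆ S` (as an inverse semigroup), every element
`t ∈ S` is computed by a straight-line program over `Sg` of length at most
`C·(1 + log₂ |S|)²`. -/
theorem stmt_8 :
    ∃ C : ℝ, 0 < C ∧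
      ∀ (S : Type*) [Semigroup S] [Fintype S] (inv : S → S),
        (∀ x : S, x * inv x * x = x) →
        (∀ x : S, inv x * x * inv x = inv x) →
        (∀ x y : S, x * y * x = x → y * x * y = y → y = inv x) →
        (∀ x : S, x * inv x = inv x * x) →
        ∀ Sg : Set S, invClosureA inv Sg = Set.univ →
          ∀ t : S, ∃ l : List S, IsSLPinv inv Sg l ∧ t ∈ l ∧
            (l.length : ℝ) ≤ C * (1 + Real.logb 2 (Fintype.card S)) ^ 2 := by
  refine ⟨12, by norm_num, ?_⟩
  intro S _ _ inv h1 h2 h3 h4 Sg hS t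
  have H : IsCliff inv := ⟨h1, h2, h3, h4⟩
  obtain ⟨k, i, hk, hi, l, hl, hlen, hmem⟩ := H.comp_all hS t
  refine ⟨l, hl, hmem t rfl, ?_⟩
  have hpos : 0 < Fintype.card S := Fintype.card_pos_iff.2 ⟨t⟩
  have hposR : (0 : ℝ) < Fintype.card S := by exact_mod_cast hpos
  set L := Real.logb 2 (Fintype.card S) with hL
  have hiL : (i : ℝ) ≤ L := by
    rw [hL, Real.le_logb_iff_rpow_le (by norm_num) hposR, Real.rpow_natCast]
    exact_mod_cast hi
  have hkL : (k : ℝ) ≤ 1 + L := by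
    have h2 : (k : ℝ) ≤ Real.logb 2 (2 * Fintype.card S) := by
      rw [Real.le_logb_iff_rpow_le (by norm_num) (by positivity), Real.rpow_natCast]
      have : 2 ^ k ≤ 2 * Fintype.card S := by omega
      exact_mod_cast this
    rwa [Real.logb_mul (by norm_num) hposR.ne', Real.logb_self_eq_one (by norm_num)] at h2
  have hi0 : (0 : ℝ) ≤ i := Nat.cast_nonneg i
  have hlenR : (l.length : ℝ) ≤ 4 * k + i ^ 2 + 8 * i + 2 := by exact_mod_cast hlen
  have hsq : (i : ℝ) ^ 2 ≤ L ^ 2 := by gcongr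
  nlinarith
end

section
/- Let U be an inverse semigroup and let e_s, e_t ∈ E(U) be idempotents. Let Y₂ = {0, 1} be the two-element semilattice and let U′ be the inverse subsemigroup of U × Y₂ generated by (e_s, 0) together with U × {1}. Then e_s ≥_J e_t in U (that is, e_t ∈ U¹ e_s U¹) holds if and only if (e_t, 0) ∈ U′. -/
/-- The two-element semilattice `Y₂ = {0, 1}` (with `1` neutral and `0` a zero). -/
abbrev Y2 : Type := WithZero Unit

/-- **Statement 17.** Let `U` be an inverse semigroup and `e_s, e_t ∈ E(U)` idempotents.
Let `Y₂ = {0,1}` be the two-element semilattice and let `U′` be the inverse subsemigroup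
of `U × Y₂` generated by `(e_s, 0)` together with `U × {1}`.  Then `e_s ≥_J e_t` in `U`
(that is, `e_t ∈ U¹ e_s U¹`) holds if and only if `(e_t, 0) ∈ U′`. -/
theorem stmt_17 {U : Type*} [Semigroup U] (inv : U → U)
    (hinv1 : ∀ x : U, x * inv x * x = x)
    (hinv2 : ∀ x : U, inv x * x * inv x = inv x)
    (hinvUniq : ∀ x y : U, x * y * x = x → y * x * y = y → y = inv x)
    (es et : U) (hes : es * es = es) (het : et * et = et) :
    (∃ p q : WithOne U, (et : WithOne U) = p * (es : WithOne U) * q) ↔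
      (et, (0 : Y2)) ∈
        invClosureA (fun p : U × Y2 => (inv p.1, p.2))
          (insert (es, (0 : Y2)) {p : U × Y2 | p.2 = 1}) := by
  constructor
  · rintro ⟨p, q, h⟩ V ⟨hX, hmul, _⟩
    have h0 : (es, (0 : Y2)) ∈ V := hX (Set.mem_insert _ _)
    have h1 : ∀ u : U, (u, (1 : Y2)) ∈ V := fun u => hX (Set.mem_insert_of_mem _ rfl)
    have hl : ∀ u x : U, (x, (0 : Y2)) ∈ V → (u * x, (0 : Y2)) ∈ V := by
      intro u x hx
      have := hmul _ (h1 u) _ hx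
      simpa using this
    have hr : ∀ u x : U, (x, (0 : Y2)) ∈ V → (x * u, (0 : Y2)) ∈ V := by
      intro u x hx
      have := hmul _ hx _ (h1 u)
      simpa using this
    induction p using WithOne.recOneCoe with
    | one =>
      induction q using WithOne.recOneCoe with
      | one =>
        rw [one_mul, mul_one] at h
        rw [WithOne.coe_inj.mp h]; exact h0
      | coe b =>
        rw [one_mul, ← WithOne.coe_mul] at h
        rw [WithOne.coe_inj.mp h]; exact hr _ _ h0
    | coe a =>
      induction q using WithOne.recOneCoe with
      | one =>
        rw [mul_one, ← WithOne.coe_mul] at h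
        rw [WithOne.coe_inj.mp h]; exact hl _ _ h0
      | coe b =>
        rw [← WithOne.coe_mul, ← WithOne.coe_mul] at h
        rw [WithOne.coe_inj.mp h]; exact hr _ _ (hl _ _ h0)
  · intro h
    have key := h {p : U × Y2 | p.2 = 1 ∨
      ∃ a b : WithOne U, (p.1 : WithOne U) = a * (es : WithOne U) * b} ?_
    · rcases key with h | h
      · exact absurd h (by simp)
      · exact h
    · refine ⟨?_, ?_, ?_⟩
      · rintro p (rfl | hp)
        · exact Or.inr ⟨1, 1, by simp⟩
        · exact Or.inl hp
      · rintro ⟨x, i⟩ hx ⟨y, j⟩ hy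
        rcases hx with hx | ⟨a, b, hx⟩
        · rcases hy with hy | ⟨a, b, hy⟩
          · left
            simp only at hx hy
            simp [hx, hy]
          · right
            refine ⟨x * a, b, ?_⟩
            simp only at hy
            simp only [Prod.mk_mul_mk, WithOne.coe_mul, hy, mul_assoc]
        · right
          refine ⟨a, b * y, ?_⟩
          simp only at hx
          simp only [Prod.mk_mul_mk, WithOne.coe_mul, hx, mul_assoc]
      · rintro ⟨x, i⟩ (hx | ⟨a, b, hx⟩)
        · exact Or.inl hx
        · right
          refine ⟨inv x * a, b * inv x, ?_⟩
          simp only at hx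
          have h2 : ((inv x : U) : WithOne U) = inv x * x * inv x := by
            rw [← WithOne.coe_mul, ← WithOne.coe_mul, hinv2]
          change ((inv x : U) : WithOne U) = _
          refine h2.trans ?_
          rw [hx]
          simp only [mul_assoc]
end

section
/- Let G be a finite group with a non-trivial element g ≠ 1 and let Γ = (V, E) be a finite simple undirected graph. For v ∈ V define g_v ∈ G^V by g_v(v) = g and g_v(u) = 1 for u ≠ v, and for u, v ∈ V set g_{uv} = g_u⁻¹ g_v. Then for all s, t ∈ V: g_{st} lies in the subgroup of G^V generated by { g_{uv} : {u,v} ∈ E } if and only if s and t lie in the same connected component of Γ. -/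
/-- The element `g_v ∈ G^V` which is `g` at the coordinate `v` and `1` elsewhere. -/
def gvec {V G : Type*} [DecidableEq V] [One G] (g : G) (v : V) : V → G :=
  fun u => if u = v then g else 1

/-- **Statement 19.** Let `G` be a finite group with a non-trivial element `g ≠ 1`, and
let `Γ = (V, E)` be a finite simple undirected graph.  For `v ∈ V` let `g_v ∈ G^V` have
value `g` at `v` and `1` elsewhere, and set `g_{uv} = g_u⁻¹ g_v`.  Then for all
`s, t ∈ V`: `g_{st}` lies in the subgroup of `G^V` generated by
`{ g_{uv} : {u,v} ∈ E }` if and only if `s` and `t` lie in the same connected component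
of `Γ`. -/
theorem stmt_19 {V G : Type*} [Fintype V] [DecidableEq V] [Group G] [Finite G]
    (Γ : SimpleGraph V) (g : G) (hg : g ≠ 1) :
    ∀ s t : V,
      (gvec g s)⁻¹ * gvec g t ∈
          Subgroup.closure {p : V → G | ∃ u v : V, Γ.Adj u v ∧ p = (gvec g u)⁻¹ * gvec g v} ↔
        Γ.Reachable s t := by
  classical
  intro s t
  constructor
  · intro h
    by_contra hst
    let C : Finset V := Finset.univ.filter (fun v => Γ.Reachable s v)
    have key : ∀ p ∈ Subgroup.closure
        {p : V → G | ∃ u v : V, Γ.Adj u v ∧ p = (gvec g u)⁻¹ * gvec g v},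
        ∃ n : V → ℤ, (∀ w, p w = g ^ n w) ∧ ∑ w ∈ C, n w = 0 := by
      intro p hp
      induction hp using Subgroup.closure_induction with
      | mem p hp =>
        obtain ⟨u, v, huv, rfl⟩ := hp
        refine ⟨fun w => -(if w = u then 1 else 0) + (if w = v then 1 else 0), ?_, ?_⟩
        · intro w
          simp only [gvec, Pi.mul_apply, Pi.inv_apply, zpow_add, zpow_neg]
          split_ifs <;> simp
        · have hC : u ∈ C ↔ v ∈ C := by
            simp only [C, Finset.mem_filter, Finset.mem_univ, true_and]
            exact ⟨fun h => h.trans huv.reachable, fun h => h.trans huv.symm.reachable⟩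
          rw [Finset.sum_add_distrib, Finset.sum_neg_distrib, Finset.sum_ite_eq',
            Finset.sum_ite_eq']
          simp [hC]
      | one => exact ⟨0, by simp, by simp⟩
      | mul x y _ _ hx hy =>
        obtain ⟨n, hn, hn'⟩ := hx
        obtain ⟨m, hm, hm'⟩ := hy
        exact ⟨n + m, by simp [hn, hm, zpow_add], by simp [Finset.sum_add_distrib, hn', hm']⟩
      | inv x _ hx =>
        obtain ⟨n, hn, hn'⟩ := hx
        exact ⟨-n, by simp [hn], by simp [hn']⟩
    obtain ⟨n, hn, hsum⟩ := key _ h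
    have hd : (orderOf g : ℤ) ∣ ∑ w ∈ C, (n w + if w = s then 1 else 0) := by
      apply Finset.dvd_sum
      intro w hw
      have hw' : Γ.Reachable s w := by simpa [C] using hw
      have hwt : w ≠ t := by
        rintro rfl
        exact hst hw'
      have h1 := hn w
      rw [orderOf_dvd_iff_zpow_eq_one, zpow_add, ← h1]
      simp only [gvec, Pi.mul_apply, Pi.inv_apply, if_neg hwt]
      split_ifs <;> simp
    have hs : s ∈ C := by simp [C]
    rw [Finset.sum_add_distrib, hsum, Finset.sum_ite_eq', if_pos hs, zero_add,
      orderOf_dvd_iff_zpow_eq_one, zpow_one] at hd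
    exact hg hd
  · rintro ⟨p⟩
    induction p with
    | nil => simp [one_mem]
    | @cons u v w h _ ih =>
      have h1 := mul_mem (Subgroup.subset_closure
        (show (gvec g u)⁻¹ * gvec g v ∈ {p : V → G | ∃ u v : V, Γ.Adj u v ∧
          p = (gvec g u)⁻¹ * gvec g v} from ⟨u, v, h, rfl⟩)) ih
      simpa [mul_assoc] using h1
end
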